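/- arXiv:1803.10349 — 2 statements merged into one kernel-verified Lean document; each statement's English description precedes it below -/
import Mathlib

section
/- Let γ ∈ (0,1) be fixed. Then the probability that the Erdős–Rényi random graph G(k, ⌈γ·binom(k,2)⌉) is γ-flat tends to 1 as k → ∞. -/
/-- The potential edge slots of a graph on vertex set `Fin k`: unordered pairs of
distinct vertices. -/
def edgeSlots (k : ℕ) : Finset (Sym2 (Fin k)) :=
  Finset.univ.filter fun e => ¬ e.IsDiag

/-- All graphs on `Fin k` with exactly `m` edges, encoded as their edge sets. -/
def graphsWithEdges (k m : ℕ) : Finset (Finset (Sym2 (Fin k))) :=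
  (edgeSlots k).powersetCard m

open scoped Classical in
/-- The probability of `event` under the Erdős–Rényi random graph `G(k,m)`, the uniform
distribution on all graphs on `Fin k` with exactly `m` edges. -/
noncomputable def erProb (k m : ℕ) (event : Finset (Sym2 (Fin k)) → Prop) : ℝ :=
  (((graphsWithEdges k m).filter fun s => event s).card : ℝ) /
    ((graphsWithEdges k m).card : ℝ)

/-- `e(A)`: the number of edges of the graph with edge set `s` having both endpoints in `A`. -/
def edgesOf {k : ℕ} (s : Finset (Sym2 (Fin k))) (A : Finset (Fin k)) : ℕ :=
  (s.filter fun e => e ∈ A.sym2).card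

/-- `D_k(ℓ) = min(T, S−T) · ℓ^{−1/2} · log k`, where `S = C(k,2)` and `T = C(ℓ,2)`. -/
noncomputable def Dflat (k ℓ : ℕ) : ℝ :=
  (min (ℓ.choose 2) (k.choose 2 - ℓ.choose 2) : ℕ) / Real.sqrt ℓ * Real.log k

/-- A graph on `Fin k` with edge set `s` is `γ`-flat if it has exactly `⌈γ·C(k,2)⌉` edges and
every vertex subset `A` with `|A| = ℓ ∈ {2,…,k−1}` satisfies `e(A) ≤ γ·C(ℓ,2) + D_k(ℓ)`. -/
def IsFlatSet (γ : ℝ) (k : ℕ) (s : Finset (Sym2 (Fin k))) : Prop :=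
  s.card = ⌈γ * (k.choose 2 : ℝ)⌉₊ ∧
  ∀ A : Finset (Fin k), 2 ≤ A.card → A.card + 1 ≤ k →
    (edgesOf s A : ℝ) ≤ γ * (A.card.choose 2 : ℝ) + Dflat k A.card

open Filter

open Finset in
theorem card_filter_subset_powersetCard {α : Type*} [DecidableEq α] {E J : Finset α} {m : ℕ}
    (hJ : J ⊆ E) (hm : J.card ≤ m) :
    ((E.powersetCard m).filter (J ⊆ ·)).card = (E.card - J.card).choose (m - J.card) := by
  rw [← card_sdiff_of_subset hJ, ← card_powersetCard]
  refine card_nbij' (· \ J) (· ∪ J) ?_ ?_ ?_ ?_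
  · intro s hs
    simp only [coe_filter, mem_powersetCard, Set.mem_ofPred_eq] at hs
    obtain ⟨⟨hsE, hsm⟩, hJs⟩ := hs
    simp only [mem_coe, mem_powersetCard]
    exact ⟨sdiff_subset_sdiff hsE le_rfl, by rw [card_sdiff_of_subset hJs, hsm]⟩
  · intro s hs
    simp only [mem_coe, mem_powersetCard] at hs
    obtain ⟨hsE, hsm⟩ := hs
    have hdisj : Disjoint s J := disjoint_of_subset_left hsE sdiff_disjoint
    simp only [coe_filter, mem_powersetCard, Set.mem_ofPred_eq]
    exact ⟨⟨union_subset (hsE.trans sdiff_subset) hJ,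
      by rw [card_union_of_disjoint hdisj, hsm]; omega⟩, subset_union_right⟩
  · intro s hs
    simp only [coe_filter, mem_powersetCard, Set.mem_ofPred_eq] at hs
    exact sdiff_union_of_subset hs.2
  · intro s hs
    simp only [mem_coe, mem_powersetCard] at hs
    exact union_sdiff_cancel_right (disjoint_of_subset_left hs.1 sdiff_disjoint)

theorem choose_sub_mul_pow_le {S m j : ℕ} (hm : m ≤ S) (hj : j ≤ m) :
    (S - j).choose (m - j) * S ^ j ≤ S.choose m * m ^ j := by
  induction j with
  | zero => simp
  | succ j ih =>
    have ih := ih (by omega)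
    obtain ⟨a, rfl⟩ : ∃ a, S = a + 1 + j := ⟨S - 1 - j, by omega⟩
    obtain ⟨b, rfl⟩ : ∃ b, m = b + 1 + j := ⟨m - 1 - j, by omega⟩
    rw [show a + 1 + j - (j + 1) = a by omega, show b + 1 + j - (j + 1) = b by omega]
    rw [show a + 1 + j - j = a + 1 by omega, show b + 1 + j - j = b + 1 by omega] at ih
    have hpascal := Nat.add_one_mul_choose_eq a b
    have hba : b ≤ a := by omega
    have hratio : (b + 1) * (a + 1 + j) ≤ (b + 1 + j) * (a + 1) := by nlinarith
    refine Nat.le_of_mul_le_mul_left ?_ (show 0 < a + 1 by omega)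
    calc (a + 1) * (a.choose b * (a + 1 + j) ^ (j + 1))
        = ((a + 1) * a.choose b) * (a + 1 + j) ^ j * (a + 1 + j) := by ring
      _ = ((a + 1).choose (b + 1) * (a + 1 + j) ^ j) * ((b + 1) * (a + 1 + j)) := by
          rw [hpascal]; ring
      _ ≤ ((a + 1 + j).choose (b + 1 + j) * (b + 1 + j) ^ j) * ((b + 1 + j) * (a + 1)) :=
          Nat.mul_le_mul ih hratio
      _ = _ := by ring

open Finset in
theorem card_filter_subset_powersetCard_le {α : Type*} [DecidableEq α] {E J : Finset α} {m : ℕ}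
    (hJ : J ⊆ E) (hm : m ≤ E.card) (hE : 0 < E.card) :
    (((E.powersetCard m).filter (J ⊆ ·)).card : ℝ) ≤
      E.card.choose m * ((m : ℝ) / E.card) ^ J.card := by
  by_cases hJm : J.card ≤ m
  · rw [card_filter_subset_powersetCard hJ hJm, div_pow, ← mul_div_assoc, le_div_iff₀ (by positivity)]
    exact_mod_cast choose_sub_mul_pow_le hm hJm
  · have hempty : (E.powersetCard m).filter (J ⊆ ·) = ∅ := by
      refine filter_eq_empty_iff.2 fun s hs hJs => hJm ?_
      exact (card_le_card hJs).trans (mem_powersetCard.1 hs).2.le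
    rw [hempty, card_empty, Nat.cast_zero]
    positivity

open Finset in
/-- The generating function of the hypergeometric distribution is dominated by that of the
binomial distribution with the same mean. -/
theorem sum_powersetCard_one_add_pow_le {α : Type*} [DecidableEq α] {E F : Finset α} {m : ℕ}
    (hF : F ⊆ E) (hm : m ≤ E.card) (hE : 0 < E.card) {x : ℝ} (hx : 0 ≤ x) :
    ∑ s ∈ E.powersetCard m, (1 + x) ^ (F ∩ s).card ≤
      E.card.choose m * (1 + (m : ℝ) / E.card * x) ^ F.card := by
  have hexpand (y : ℝ) (U : Finset α) : (1 + y) ^ U.card = ∑ J ∈ U.powerset, y ^ J.card := by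
    simpa [add_comm] using (sum_pow_mul_eq_add_pow y 1 U).symm
  calc ∑ s ∈ E.powersetCard m, (1 + x) ^ (F ∩ s).card
      = ∑ s ∈ E.powersetCard m, ∑ J ∈ F.powerset, if J ⊆ s then x ^ J.card else 0 := by
        refine sum_congr rfl fun s _ => ?_
        rw [hexpand, ← sum_filter]
        refine sum_congr ?_ fun _ _ => rfl
        ext J
        simp only [mem_filter, mem_powerset, subset_inter_iff]
    _ = ∑ J ∈ F.powerset, ((E.powersetCard m).filter (J ⊆ ·)).card * x ^ J.card := by
        rw [sum_comm]
        refine sum_congr rfl fun J _ => ?_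
        rw [← sum_filter, sum_const, nsmul_eq_mul]
    _ ≤ ∑ J ∈ F.powerset, E.card.choose m * ((m : ℝ) / E.card * x) ^ J.card := by
        refine sum_le_sum fun J hJ => ?_
        rw [mul_pow, ← mul_assoc]
        exact mul_le_mul_of_nonneg_right
          (card_filter_subset_powersetCard_le ((mem_powerset.1 hJ).trans hF) hm hE) (by positivity)
    _ = _ := by rw [← mul_sum, hexpand]

open Finset in
/-- Upper tail bound for the hypergeometric distribution. -/
theorem card_filter_inter_tail_le {α : Type*} [DecidableEq α] {E F : Finset α} {m : ℕ}
    (hF : F ⊆ E) (hm : m ≤ E.card) (hF0 : 0 < F.card) {t : ℝ} (ht : 0 ≤ t) :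
    (((E.powersetCard m).filter
        fun s => (m : ℝ) / E.card * F.card + t ≤ (F ∩ s).card).card : ℝ) ≤
      E.card.choose m * Real.exp (-(t ^ 2 / (4 * F.card))) := by
  have hE : 0 < E.card := hF0.trans_le (card_le_card hF)
  have hn : (0 : ℝ) < F.card := by exact_mod_cast hF0
  set p : ℝ := (m : ℝ) / E.card with hp
  have hp0 : 0 ≤ p := by positivity
  have hp1 : p ≤ 1 := div_le_one_of_le₀ (by exact_mod_cast hm) (by positivity)
  by_cases htF : t ≤ F.card
  swap
  · rw [filter_eq_empty_iff.2, card_empty, Nat.cast_zero]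
    · positivity
    · intro s _ h
      have hle : ((F ∩ s).card : ℝ) ≤ F.card := by exact_mod_cast card_le_card inter_subset_left
      nlinarith [mul_nonneg hp0 hn.le]
  obtain ⟨l, rfl⟩ : ∃ l, t = l * (2 * F.card) :=
    ⟨t / (2 * F.card), (div_mul_cancel₀ t (by positivity)).symm⟩
  have hl0 : 0 ≤ l := nonneg_of_mul_nonneg_left ht (by positivity)
  have hl1 : l ≤ 1 := by nlinarith
  have hexp0 : 0 ≤ Real.exp l - 1 := by linarith [Real.add_one_le_exp l]
  have hexp : Real.exp l - 1 ≤ l + l ^ 2 := by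
    have h := Real.abs_exp_sub_one_sub_id_le (x := l) (by rwa [abs_of_nonneg hl0])
    linarith [le_abs_self (Real.exp l - 1 - l)]
  have hmgf : 1 + p * (Real.exp l - 1) ≤ Real.exp (p * l + l ^ 2) := by
    have h := Real.add_one_le_exp (p * l + l ^ 2)
    nlinarith [mul_le_mul_of_nonneg_left hexp hp0, mul_le_mul_of_nonneg_right hp1 (sq_nonneg l)]
  have hmarkov : (((E.powersetCard m).filter fun s => p * F.card + l * (2 * F.card) ≤ (F ∩ s).card).card : ℝ) *
      Real.exp (l * (p * F.card + l * (2 * F.card))) ≤ ∑ s ∈ E.powersetCard m, (1 + (Real.exp l - 1)) ^ (F ∩ s).card := by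
    rw [← nsmul_eq_mul, ← sum_const, sum_filter]
    refine sum_le_sum fun s _ => ?_
    rw [add_sub_cancel, ← Real.exp_nat_mul]
    split_ifs with h
    · refine Real.exp_le_exp.2 ?_
      rw [mul_comm]
      exact mul_le_mul_of_nonneg_right h hl0
    · positivity
  have hbound := hmarkov.trans (sum_powersetCard_one_add_pow_le hF hm hE hexp0)
  rw [← le_div_iff₀ (Real.exp_pos _)] at hbound
  refine hbound.trans ?_
  rw [mul_div_assoc]
  refine mul_le_mul_of_nonneg_left ?_ (by positivity)
  rw [div_le_iff₀ (Real.exp_pos _), ← Real.exp_add]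
  refine (pow_le_pow_left₀ (by positivity) hmgf _).trans ?_
  rw [← Real.exp_nat_mul]
  refine Real.exp_le_exp.2 (le_of_eq ?_)
  have hquot : (l * (2 * F.card)) ^ 2 / (4 * F.card) = l ^ 2 * (F.card : ℝ) := by
    rw [div_eq_iff (by positivity)]
    ring
  rw [hquot]
  ring

open Finset in
/-- Lower tail bound for the hypergeometric distribution, in terms of the complementary set. -/
theorem card_filter_sdiff_tail_le {α : Type*} [DecidableEq α] {E F : Finset α} {m : ℕ}
    (hF : F ⊆ E) (hm : m ≤ E.card) (hF0 : 0 < F.card) {t : ℝ} (ht : 0 ≤ t) :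
    (((E.powersetCard m).filter
        fun s => (1 - (m : ℝ) / E.card) * F.card + t ≤ (F \ s).card).card : ℝ) ≤
      E.card.choose m * Real.exp (-(t ^ 2 / (4 * F.card))) := by
  have hE : (0 : ℝ) < E.card := by exact_mod_cast hF0.trans_le (card_le_card hF)
  have h := card_filter_inter_tail_le hF (Nat.sub_le E.card m) hF0 ht
  rw [Nat.choose_symm hm, Nat.cast_sub hm, sub_div, div_self hE.ne'] at h
  refine le_trans (Nat.cast_le.2 (card_le_card_of_injOn (E \ ·) ?_ ?_)) h
  · intro s hs
    simp only [coe_filter, mem_powersetCard, Set.mem_ofPred_eq] at hs ⊢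
    obtain ⟨⟨hsE, hsm⟩, hs⟩ := hs
    refine ⟨⟨sdiff_subset, by rw [card_sdiff_of_subset hsE, hsm]⟩, ?_⟩
    rwa [← inter_sdiff_assoc, inter_eq_left.2 hF]
  · intro s hs u hu hsu
    simp only [coe_filter, mem_powersetCard, Set.mem_ofPred_eq] at hs hu
    rw [← Finset.sdiff_sdiff_eq_self hs.1.1, ← Finset.sdiff_sdiff_eq_self hu.1.1]
    exact congrArg (E \ ·) hsu

open Finset in
theorem card_edgeSlots_filter {k : ℕ} (A : Finset (Fin k)) :
    ((edgeSlots k).filter (· ∈ A.sym2)).card = A.card.choose 2 := by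
  rw [← Sym2.card_image_offDiag]
  congr 1
  ext e
  induction e with
  | _ a b =>
    simp only [edgeSlots, mem_filter, mem_univ, true_and, Sym2.mk_isDiag_iff, mk_mem_sym2_iff,
      mem_image, mem_offDiag, Prod.exists, Function.uncurry_apply_pair, Sym2.eq_iff]
    constructor
    · rintro ⟨hab, ha, hb⟩
      exact ⟨a, b, ⟨ha, hb, hab⟩, Or.inl ⟨rfl, rfl⟩⟩
    · rintro ⟨x, y, ⟨hx, hy, hxy⟩, ⟨rfl, rfl⟩ | ⟨rfl, rfl⟩⟩
      · exact ⟨hxy, hx, hy⟩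
      · exact ⟨Ne.symm hxy, hy, hx⟩

open Finset in
theorem card_edgeSlots (k : ℕ) : (edgeSlots k).card = k.choose 2 := by
  have h := card_edgeSlots_filter (univ : Finset (Fin k))
  rwa [card_univ, Fintype.card_fin, filter_true_of_mem fun e _ => by simp] at h

theorem one_le_half_deviation {n l h L : ℝ} (hl : 1 ≤ l) (hh : 1 ≤ h) (hL : 8 ≤ L)
    (hn : l * h / 4 ≤ n) : 1 ≤ n / √l * L / 2 := by
  have hsqrt : 1 ≤ √l := Real.one_le_sqrt.2 hl
  have hdiv : 1 / 4 ≤ n / √l := by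
    rw [le_div_iff₀ (by linarith)]
    nlinarith [Real.sq_sqrt (show 0 ≤ l by linarith)]
  nlinarith

theorem half_deviation_sq_div {n l h L : ℝ} (hl : 1 ≤ l) (hh : 1 ≤ h)
    (hn : l * h / 4 ≤ n) : h * (L ^ 2 / 64) ≤ (n / √l * L / 2) ^ 2 / (4 * n) := by
  have hl0 : 0 < l := by linarith
  have hn0 : 0 < n := by nlinarith
  have heq : (n / √l * L / 2) ^ 2 / (4 * n) = n / l * (L ^ 2 / 16) := by
    rw [div_pow, mul_pow, div_pow, Real.sq_sqrt hl0.le]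
    field_simp
    ring
  have hdiv : h / 4 ≤ n / l := by rw [le_div_iff₀ hl0]; linarith
  rw [heq]
  nlinarith [mul_le_mul_of_nonneg_right hdiv (show 0 ≤ L ^ 2 / 16 by positivity)]

open Finset in
theorem card_filter_not_flat_at_le {γ : ℝ} (hγ0 : 0 < γ) (hγ1 : γ < 1) {k : ℕ}
    (hk : 8 ≤ Real.log k) (A : Finset (Fin k)) (hA : 2 ≤ A.card) (hAk : A.card + 1 ≤ k) :
    (((graphsWithEdges k ⌈γ * (k.choose 2 : ℝ)⌉₊).filter fun s =>
        γ * (A.card.choose 2 : ℝ) + Dflat k A.card < edgesOf s A).card : ℝ) ≤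
      (graphsWithEdges k ⌈γ * (k.choose 2 : ℝ)⌉₊).card *
        (Real.exp (-(Real.log k ^ 2 / 64)) ^ A.card +
          Real.exp (-(Real.log k ^ 2 / 64)) ^ (k - A.card)) := by
  set m := ⌈γ * (k.choose 2 : ℝ)⌉₊ with hm_def
  set E := edgeSlots k with hE_def
  set F := E.filter (· ∈ A.sym2) with hF_def
  set L := Real.log k with hL_def
  have hEc : E.card = k.choose 2 := card_edgeSlots k
  have hFc : F.card = A.card.choose 2 := card_edgeSlots_filter A
  have hFE : F ⊆ E := filter_subset _ _
  have hFE' : (E \ F).card = k.choose 2 - A.card.choose 2 := by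
    rw [card_sdiff_of_subset hFE, hEc, hFc]
  have hFleE : F.card ≤ E.card := card_le_card hFE
  have hsub : ((E \ F).card : ℝ) = E.card - F.card := by
    rw [card_sdiff_of_subset hFE, Nat.cast_sub hFleE]
  have hl : (2 : ℝ) ≤ A.card := by exact_mod_cast hA
  have hlk : (A.card : ℝ) + 1 ≤ k := by exact_mod_cast hAk
  have hFreal : (F.card : ℝ) = A.card * (A.card - 1) / 2 := by rw [hFc, Nat.cast_choose_two]
  have hEreal : (E.card : ℝ) = k * (k - 1) / 2 := by rw [hEc, Nat.cast_choose_two]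
  have hE0 : (0 : ℝ) < E.card := by rw [hEreal]; nlinarith
  have hmE : m ≤ E.card := by
    rw [hm_def, hEc]
    refine Nat.ceil_le.2 ?_
    nlinarith [(Nat.cast_nonneg (k.choose 2) : (0 : ℝ) ≤ _)]
  have hmlt : (m : ℝ) < γ * E.card + 1 := by
    rw [hm_def, hEc]
    exact Nat.ceil_lt_add_one (by positivity)
  set p : ℝ := (m : ℝ) / E.card with hp_def
  have hpF : p * F.card ≤ γ * F.card + 1 := by
    have hFle : (F.card : ℝ) ≤ E.card := by exact_mod_cast hFleE
    have hp : p * E.card = m := by rw [hp_def]; field_simp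
    have hgap : (p - γ) * E.card ≤ 1 := by linarith
    by_cases hpg : p ≤ γ
    · nlinarith [mul_le_mul_of_nonneg_right hpg (Nat.cast_nonneg F.card : (0 : ℝ) ≤ _)]
    · nlinarith [mul_le_mul_of_nonneg_left hFle (show 0 ≤ p - γ by linarith)]
  have hcard : (graphsWithEdges k m).card = E.card.choose m := card_powersetCard _ _
  have hinter {s : Finset (Sym2 (Fin k))} (hs : s ∈ E.powersetCard m) :
      edgesOf s A = (F ∩ s).card := by
    unfold edgesOf
    congr 1
    ext e
    have := @(mem_powersetCard.1 hs).1 e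
    simp only [hF_def, mem_filter, mem_inter]
    tauto
  have hexp (h : ℕ) : Real.exp (-(L ^ 2 / 64)) ^ h = Real.exp (-(h * (L ^ 2 / 64))) := by
    rw [← Real.exp_nat_mul]; congr 1; ring
  rw [hcard]
  rcases le_total (A.card.choose 2) (k.choose 2 - A.card.choose 2) with hmin | hmin
  · have hD : Dflat k A.card = F.card / √A.card * L := by
      rw [Dflat, min_eq_left hmin, hFc]
    have hn : (A.card : ℝ) * A.card / 4 ≤ F.card := by rw [hFreal]; nlinarith
    have hF0 : 0 < F.card := by
      have : (0 : ℝ) < F.card := by nlinarith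
      exact_mod_cast this
    have hhalf := one_le_half_deviation (h := A.card) (L := L) (by linarith) (by linarith) hk hn
    have hquad := half_deviation_sq_div (h := A.card) (L := L) (by linarith) (by linarith) hn
    set D := Dflat k A.card
    rw [← hD] at hhalf hquad
    calc _ ≤ (((E.powersetCard m).filter
              fun s => p * F.card + D / 2 ≤ (F ∩ s).card).card : ℝ) := by
          refine Nat.cast_le.2 (card_le_card fun s hs => ?_)
          obtain ⟨hs, hbad⟩ := mem_filter.1 hs
          refine mem_filter.2 ⟨hs, ?_⟩
          rw [hinter hs, ← hFc] at hbad
          linarith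
      _ ≤ E.card.choose m * Real.exp (-((D / 2) ^ 2 / (4 * F.card))) :=
          card_filter_inter_tail_le hFE hmE hF0 (by linarith)
      _ ≤ _ := by
          refine mul_le_mul_of_nonneg_left ?_ (by positivity)
          refine le_trans ?_ (le_add_of_nonneg_right (by positivity))
          rw [hexp]
          exact Real.exp_le_exp.2 (neg_le_neg hquad)
  · have hD : Dflat k A.card = (E \ F).card / √A.card * L := by
      rw [Dflat, min_eq_right hmin, hFE']
    have hj : ((k - A.card : ℕ) : ℝ) = k - A.card := Nat.cast_sub (by omega)
    have hn : (A.card : ℝ) * (k - A.card : ℕ) / 4 ≤ (E \ F).card := by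
      rw [hsub, hFreal, hEreal, hj]
      nlinarith [mul_nonneg (show (0 : ℝ) ≤ k - A.card by linarith)
        (show (0 : ℝ) ≤ k - A.card - 1 by linarith),
        mul_nonneg (show (0 : ℝ) ≤ k - A.card by linarith) (show (0 : ℝ) ≤ A.card by linarith)]
    have hF0 : 0 < (E \ F).card := by
      have : (0 : ℝ) < (E \ F).card := by nlinarith
      exact_mod_cast this
    have hhalf := one_le_half_deviation (h := (k - A.card : ℕ)) (L := L) (by linarith)
      (by linarith) hk hn
    have hquad := half_deviation_sq_div (h := (k - A.card : ℕ)) (L := L) (by linarith)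
      (by linarith) hn
    set D := Dflat k A.card
    rw [← hD] at hhalf hquad
    calc _ ≤ (((E.powersetCard m).filter
              fun s => (1 - p) * (E \ F).card + D / 2 ≤ ((E \ F) \ s).card).card : ℝ) := by
          refine Nat.cast_le.2 (card_le_card fun s hs => ?_)
          obtain ⟨hs, hbad⟩ := mem_filter.1 hs
          refine mem_filter.2 ⟨hs, ?_⟩
          rw [hinter hs, ← hFc] at hbad
          obtain ⟨hsE, hsm⟩ := mem_powersetCard.1 hs
          have hcount : ((E \ F) \ s).card + F.card + m = E.card + (F ∩ s).card := by
            rw [sdiff_sdiff_left, add_assoc, ← hsm, ← card_union_add_card_inter, ← add_assoc,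
              sup_eq_union, card_sdiff_add_card_eq_card (union_subset hFE hsE)]
          have hcount' : (((E \ F) \ s).card : ℝ) + F.card + m = E.card + (F ∩ s).card := by
            exact_mod_cast hcount
          have hp : p * E.card = m := by rw [hp_def]; field_simp
          rw [hsub]
          linarith
      _ ≤ E.card.choose m * Real.exp (-((D / 2) ^ 2 / (4 * (E \ F).card))) :=
          card_filter_sdiff_tail_le sdiff_subset hmE hF0 (by linarith)
      _ ≤ _ := by
          refine mul_le_mul_of_nonneg_left ?_ (by positivity)
          refine le_trans ?_ (le_add_of_nonneg_left (by positivity))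
          rw [hexp]
          exact Real.exp_le_exp.2 (neg_le_neg hquad)

open Finset in
theorem sum_pow_card_add_pow_sub_card_le {k : ℕ} {q : ℝ} (hq : 0 ≤ q) :
    ∑ A : Finset (Fin k) with 2 ≤ A.card ∧ A.card + 1 ≤ k, (q ^ A.card + q ^ (k - A.card)) ≤
      2 * ((1 + q) ^ k - 1) := by
  have hsum : ∑ A : Finset (Fin k), q ^ A.card = (1 + q) ^ k := by
    simpa [add_comm] using Fin.sum_pow_mul_eq_add_pow q 1 (n := k)
  have hsum' : ∑ A : Finset (Fin k), q ^ (k - A.card) = (1 + q) ^ k := by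
    simpa using Fin.sum_pow_mul_eq_add_pow 1 q (n := k)
  have h₁ : ∑ A : Finset (Fin k) with 2 ≤ A.card ∧ A.card + 1 ≤ k, q ^ A.card ≤
      (1 + q) ^ k - 1 := by
    rw [← hsum, ← add_sum_erase univ _ (mem_univ (∅ : Finset (Fin k))), card_empty, pow_zero,
      add_sub_cancel_left]
    refine sum_le_sum_of_subset_of_nonneg (fun A hA => ?_) fun _ _ _ => by positivity
    refine mem_erase.2 ⟨?_, mem_univ _⟩
    rintro rfl
    simp at hA
  have h₂ : ∑ A : Finset (Fin k) with 2 ≤ A.card ∧ A.card + 1 ≤ k, q ^ (k - A.card) ≤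
      (1 + q) ^ k - 1 := by
    rw [← hsum', ← add_sum_erase univ _ (mem_univ (univ : Finset (Fin k))), card_univ,
      Fintype.card_fin, Nat.sub_self, pow_zero, add_sub_cancel_left]
    refine sum_le_sum_of_subset_of_nonneg (fun A hA => ?_) fun _ _ _ => by positivity
    refine mem_erase.2 ⟨?_, mem_univ _⟩
    rintro rfl
    simp at hA
  rw [sum_add_distrib]
  linarith

open Finset in
theorem one_sub_erProb_isFlatSet_le {γ : ℝ} (hγ0 : 0 < γ) (hγ1 : γ < 1) {k : ℕ}
    (hk : 8 ≤ Real.log k) :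
    1 - erProb k ⌈γ * (k.choose 2 : ℝ)⌉₊ (IsFlatSet γ k) ≤
      2 * ((1 + Real.exp (-(Real.log k ^ 2 / 64))) ^ k - 1) := by
  classical
  set m := ⌈γ * (k.choose 2 : ℝ)⌉₊ with hm_def
  set q := Real.exp (-(Real.log k ^ 2 / 64))
  have hmS : m ≤ k.choose 2 := by
    refine Nat.ceil_le.2 ?_
    nlinarith [(Nat.cast_nonneg (k.choose 2) : (0 : ℝ) ≤ _)]
  have hG : (0 : ℝ) < (graphsWithEdges k m).card := by
    rw [graphsWithEdges, card_powersetCard, card_edgeSlots]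
    exact_mod_cast Nat.choose_pos hmS
  have hunion : (graphsWithEdges k m).filter (fun s => ¬ IsFlatSet γ k s) ⊆
      ({A : Finset (Fin k) | 2 ≤ A.card ∧ A.card + 1 ≤ k} : Finset _).biUnion fun A =>
        (graphsWithEdges k m).filter fun s =>
          γ * (A.card.choose 2 : ℝ) + Dflat k A.card < edgesOf s A := by
    intro s hs
    obtain ⟨hs, hbad⟩ := mem_filter.1 hs
    have hcard : s.card = m := (mem_powersetCard.1 hs).2
    simp only [IsFlatSet, ← hm_def, hcard, true_and] at hbad
    push Not at hbad
    obtain ⟨A, hA, hAk, h⟩ := hbad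
    exact mem_biUnion.2 ⟨A, mem_filter.2 ⟨mem_univ _, hA, hAk⟩, mem_filter.2 ⟨hs, h⟩⟩
  have hbad : (((graphsWithEdges k m).filter (fun s => ¬ IsFlatSet γ k s)).card : ℝ) ≤
      (graphsWithEdges k m).card * (2 * ((1 + q) ^ k - 1)) := by
    calc _ ≤ ∑ A : Finset (Fin k) with 2 ≤ A.card ∧ A.card + 1 ≤ k,
          (((graphsWithEdges k m).filter fun s =>
            γ * (A.card.choose 2 : ℝ) + Dflat k A.card < edgesOf s A).card : ℝ) := by
          exact_mod_cast (card_le_card hunion).trans card_biUnion_le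
      _ ≤ ∑ A : Finset (Fin k) with 2 ≤ A.card ∧ A.card + 1 ≤ k,
          (graphsWithEdges k m).card * (q ^ A.card + q ^ (k - A.card)) := by
          refine sum_le_sum fun A hA => ?_
          obtain ⟨-, hA, hAk⟩ := mem_filter.1 hA
          exact card_filter_not_flat_at_le hγ0 hγ1 hk A hA hAk
      _ ≤ _ := by
          rw [← mul_sum]
          exact mul_le_mul_of_nonneg_left
            (sum_pow_card_add_pow_sub_card_le (Real.exp_pos _).le) hG.le
  have hsplit : (((graphsWithEdges k m).filter (fun s => IsFlatSet γ k s)).card : ℝ) +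
      ((graphsWithEdges k m).filter (fun s => ¬ IsFlatSet γ k s)).card =
        (graphsWithEdges k m).card := by
    exact_mod_cast card_filter_add_card_filter_not (s := graphsWithEdges k m) (IsFlatSet γ k)
  have hprob : 1 - erProb k m (IsFlatSet γ k) =
      ((graphsWithEdges k m).filter (fun s => ¬ IsFlatSet γ k s)).card /
        (graphsWithEdges k m).card := by
    rw [erProb, eq_div_iff hG.ne', sub_mul, div_mul_cancel₀ _ hG.ne', one_mul, ← hsplit]
    convert add_sub_cancel_left _ _
  rw [hprob, div_le_iff₀ hG, mul_comm]
  exact hbad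

theorem erProb_le_one (k m : ℕ) (event : Finset (Sym2 (Fin k)) → Prop) :
    erProb k m event ≤ 1 := by
  classical
  exact div_le_one_of_le₀ (Nat.cast_le.2 (Finset.card_filter_le _ _)) (by positivity)

theorem tendsto_one_add_exp_neg_log_sq_pow :
    Tendsto (fun k : ℕ => (1 + Real.exp (-(Real.log k ^ 2 / 64))) ^ k) atTop (nhds 1) := by
  have hlog : Tendsto (fun k : ℕ => Real.log k) atTop atTop :=
    Real.tendsto_log_atTop.comp tendsto_natCast_atTop_atTop
  have hupper : Tendsto (fun k : ℕ => Real.exp (Real.exp (-Real.log k))) atTop (nhds 1) := by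
    have h := Real.tendsto_exp_neg_atTop_nhds_zero.comp hlog
    simpa [Function.comp_def] using (Real.continuous_exp.tendsto 0).comp h
  refine tendsto_of_tendsto_of_tendsto_of_le_of_le' tendsto_const_nhds hupper ?_ ?_
  · exact Eventually.of_forall fun k => one_le_pow₀ (by linarith [Real.exp_pos (-(Real.log k ^ 2 / 64))])
  · filter_upwards [hlog.eventually_ge_atTop 128, eventually_gt_atTop 0] with k hk hk0
    have hk0' : (0 : ℝ) < k := by exact_mod_cast hk0
    have h := Real.add_one_le_exp (Real.exp (-(Real.log k ^ 2 / 64)))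
    rw [add_comm] at h
    refine (pow_le_pow_left₀ (by positivity) h k).trans ?_
    rw [← Real.exp_nat_mul]
    refine Real.exp_le_exp.2 ?_
    nth_rewrite 1 [← Real.exp_log hk0']
    rw [← Real.exp_add]
    refine Real.exp_le_exp.2 ?_
    nlinarith

/-- For fixed `γ ∈ (0,1)`, the Erdős–Rényi random graph `G(k, ⌈γ·C(k,2)⌉)` is `γ`-flat with
high probability as `k → ∞`. -/
theorem er_isFlat_whp (γ : ℝ) (hγ0 : 0 < γ) (hγ1 : γ < 1) :
    Tendsto (fun k : ℕ => erProb k ⌈γ * (k.choose 2 : ℝ)⌉₊ (IsFlatSet γ k))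
      atTop (nhds 1) := by
  have hlower : Tendsto
      (fun k : ℕ => 1 - 2 * ((1 + Real.exp (-(Real.log k ^ 2 / 64))) ^ k - 1)) atTop (nhds 1) := by
    simpa using ((tendsto_one_add_exp_neg_log_sq_pow.sub_const 1).const_mul 2).const_sub 1
  have hlog : Tendsto (fun k : ℕ => Real.log k) atTop atTop :=
    Real.tendsto_log_atTop.comp tendsto_natCast_atTop_atTop
  refine tendsto_of_tendsto_of_tendsto_of_le_of_le' hlower tendsto_const_nhds ?_
    (Eventually.of_forall fun k => erProb_le_one _ _ _)
  filter_upwards [hlog.eventually_ge_atTop 8] with k hk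
  linarith [one_sub_erProb_isFlatSet_le hγ0 hγ1 hk]
end

section
/- Let 0<p<γ<1 be fixed reals, let α(γ,p) = γ·log(γ/p) + (1−γ)·log((1−γ)/(1−p)), and let λ = 2·(γ/(1−γ))·((1−p)/p). For integers k ≥ 3 and ℓ ∈ {2,…,k−1}, set S = binom(k,2), T = binom(ℓ,2), R = S−T, and for integers 0 ≤ L ≤ T define R_ℓ(L) = binom(T,L)·binom(R, ⌈γS⌉−L)²·binom(S, ⌈γS⌉)^{−2}·p^{−L}·(1−p)^{L−T}. Then there exist a constant C>0 (depending only on γ and p) and k₀ such that for all k ≥ k₀, all ℓ ∈ {2,…,k−1}, and all integers r ≥ 0 with ⌊γT⌋ + r ≤ T, one has R_ℓ(⌊γT⌋ + r) ≤ λ^r · e^{T·α(γ,p) + C}. -/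
/-- `α(γ,p) = γ log(γ/p) + (1-γ) log((1-γ)/(1-p))`. -/
noncomputable def alphaQC (γ p : ℝ) : ℝ :=
  γ * Real.log (γ / p) + (1 - γ) * Real.log ((1 - γ) / (1 - p))

/-- Binomial coefficient `C(a,b)` for an integer `b`, with the convention that it is `0`
when `b < 0` (or `b > a`). -/
def chooseZ (a : ℕ) (b : ℤ) : ℕ :=
  if 0 ≤ b then a.choose b.toNat else 0

/-- `R_ℓ(L) = C(T,L)·C(R,⌈γS⌉−L)²·C(S,⌈γS⌉)⁻²·p^{−L}·(1−p)^{L−T}`, where `S = C(k,2)`,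
`T = C(ℓ,2)` and `R = S − T`. -/
noncomputable def Rquot (γ p : ℝ) (k ℓ L : ℕ) : ℝ :=
  ((ℓ.choose 2).choose L : ℝ) *
    ((chooseZ (k.choose 2 - ℓ.choose 2) ((⌈γ * (k.choose 2 : ℝ)⌉₊ : ℤ) - (L : ℤ)) : ℝ)) ^ 2 *
    (((k.choose 2).choose ⌈γ * (k.choose 2 : ℝ)⌉₊ : ℝ)) ⁻¹ ^ 2 *
    p ^ (-(L : ℤ)) * (1 - p) ^ ((L : ℤ) - (ℓ.choose 2 : ℤ))

/-- The binomial probability of `i` successes and `j` failures, with success probability `γ`. -/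
noncomputable def binomialWeight (γ : ℝ) (i j : ℕ) : ℝ :=
  ((i + j).choose i : ℝ) * γ ^ i * (1 - γ) ^ j

/-- The elementary factor `√n (n/e)^n` of Stirling's formula. -/
noncomputable def stirlingFactor (n : ℕ) : ℝ :=
  √n * (n / Real.exp 1) ^ n

/-- The exponential factor of the Stirling approximation to `binomialWeight γ i j`. -/
noncomputable def entropyFactor (γ : ℝ) (i j : ℕ) : ℝ :=
  ((i + j : ℝ) * γ / i) ^ i * ((i + j : ℝ) * (1 - γ) / j) ^ j

theorem stirlingFactor_pos {n : ℕ} (hn : 0 < n) : 0 < stirlingFactor n := by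
  unfold stirlingFactor
  positivity

theorem two_mul_stirlingFactor_le_factorial (n : ℕ) :
    2 * stirlingFactor n ≤ (n.factorial : ℝ) := by
  refine le_trans ?_ (Stirling.le_factorial_stirling n)
  unfold stirlingFactor
  rw [Real.sqrt_mul (by positivity), ← mul_assoc]
  gcongr
  exact Real.le_sqrt_of_sq_le (by linarith [Real.pi_gt_three])

theorem factorial_le_three_mul_stirlingFactor {n : ℕ} (hn : 0 < n) :
    (n.factorial : ℝ) ≤ 3 * stirlingFactor n := by
  obtain ⟨m, rfl⟩ : ∃ m, n = m + 1 := ⟨n - 1, by omega⟩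
  have h : Stirling.stirlingSeq (m + 1) ≤ Stirling.stirlingSeq 1 :=
    Stirling.stirlingSeq'_antitone (Nat.zero_le m)
  rw [Stirling.stirlingSeq_one, Stirling.stirlingSeq, div_le_div_iff₀ (by positivity)
    (by positivity), Real.sqrt_mul (by norm_num)] at h
  have h2 : (0 : ℝ) < √2 := by positivity
  have hg := stirlingFactor_pos hn
  have h' : ((m + 1).factorial : ℝ) ≤ Real.exp 1 * stirlingFactor (m + 1) := by
    refine le_of_mul_le_mul_right (h.trans_eq ?_) h2
    unfold stirlingFactor
    ring
  nlinarith [Real.exp_one_lt_d9]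

theorem stirlingFactor_add_mul (γ : ℝ) {i j : ℕ} (hi : 0 < i) (hj : 0 < j) :
    stirlingFactor (i + j) * γ ^ i * (1 - γ) ^ j =
      √(i + j : ℝ) / (√i * √j) * entropyFactor γ i j * (stirlingFactor i * stirlingFactor j) := by
  have hi' : (0 : ℝ) < i := by exact_mod_cast hi
  have hj' : (0 : ℝ) < j := by exact_mod_cast hj
  unfold stirlingFactor entropyFactor
  push_cast
  simp only [div_pow, mul_pow, pow_add]
  field_simp

theorem choose_mul_factorials (i j : ℕ) :
    ((i + j).choose i : ℝ) * (i.factorial * j.factorial) = ((i + j).factorial : ℝ) := by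
  rw [← mul_assoc]
  rw [Nat.choose_symm_add]
  exact_mod_cast Nat.add_choose_mul_factorial_mul_factorial i j

theorem entropyFactor_nonneg {γ : ℝ} (h0 : 0 < γ) (h1 : γ < 1) (i j : ℕ) :
    0 ≤ entropyFactor γ i j := by
  have : 0 < 1 - γ := by linarith
  unfold entropyFactor
  positivity

theorem binomialWeight_le_sqrt_mul_entropyFactor {γ : ℝ} (h0 : 0 < γ) (h1 : γ < 1) {i j : ℕ}
    (hi : 0 < i) (hj : 0 < j) :
    binomialWeight γ i j ≤ √(i + j : ℝ) / (√i * √j) * entropyFactor γ i j := by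
  have hδ : 0 < 1 - γ := by linarith
  have hgi := stirlingFactor_pos hi
  have hgj := stirlingFactor_pos hj
  have hE := entropyFactor_nonneg h0 h1 i j
  refine le_of_mul_le_mul_right (a := 4 * (stirlingFactor i * stirlingFactor j)) ?_ (by positivity)
  calc binomialWeight γ i j * (4 * (stirlingFactor i * stirlingFactor j))
      = ((i + j).choose i : ℝ) * ((2 * stirlingFactor i) * (2 * stirlingFactor j)) *
          (γ ^ i * (1 - γ) ^ j) := by unfold binomialWeight; ring
    _ ≤ ((i + j).choose i : ℝ) * (i.factorial * j.factorial) * (γ ^ i * (1 - γ) ^ j) := by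
        gcongr
        · exact two_mul_stirlingFactor_le_factorial i
        · exact two_mul_stirlingFactor_le_factorial j
    _ ≤ 3 * stirlingFactor (i + j) * (γ ^ i * (1 - γ) ^ j) := by
        rw [choose_mul_factorials]
        gcongr
        exact factorial_le_three_mul_stirlingFactor (by omega)
    _ = 3 * (stirlingFactor (i + j) * γ ^ i * (1 - γ) ^ j) := by ring
    _ ≤ _ := by
        rw [stirlingFactor_add_mul γ hi hj]
        have : 0 ≤ √(i + j : ℝ) / (√i * √j) * entropyFactor γ i j *
          (stirlingFactor i * stirlingFactor j) := by positivity
        linarith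

theorem sqrt_mul_entropyFactor_le_binomialWeight {γ : ℝ} (h0 : 0 < γ) (h1 : γ < 1) {i j : ℕ}
    (hi : 0 < i) (hj : 0 < j) :
    √(i + j : ℝ) / (√i * √j) * entropyFactor γ i j ≤ 9 / 2 * binomialWeight γ i j := by
  have hδ : 0 < 1 - γ := by linarith
  have hgi := stirlingFactor_pos hi
  have hgj := stirlingFactor_pos hj
  refine le_of_mul_le_mul_right (a := 2 * (stirlingFactor i * stirlingFactor j)) ?_ (by positivity)
  calc _ = 2 * stirlingFactor (i + j) * (γ ^ i * (1 - γ) ^ j) := by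
        linear_combination (-2) * stirlingFactor_add_mul γ hi hj
    _ ≤ ((i + j).choose i : ℝ) * (i.factorial * j.factorial) * (γ ^ i * (1 - γ) ^ j) := by
        rw [choose_mul_factorials]
        gcongr
        exact two_mul_stirlingFactor_le_factorial (i + j)
    _ ≤ ((i + j).choose i : ℝ) * ((3 * stirlingFactor i) * (3 * stirlingFactor j)) *
          (γ ^ i * (1 - γ) ^ j) := by
        gcongr
        · exact factorial_le_three_mul_stirlingFactor hi
        · exact factorial_le_three_mul_stirlingFactor hj
    _ = _ := by unfold binomialWeight; ring

theorem entropyFactor_le_one {γ : ℝ} (h0 : 0 < γ) (h1 : γ < 1) {i j : ℕ}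
    (hi : 0 < i) (hj : 0 < j) : entropyFactor γ i j ≤ 1 := by
  have hδ : 0 < 1 - γ := by linarith
  have hi' : (0 : ℝ) < i := by exact_mod_cast hi
  have hj' : (0 : ℝ) < j := by exact_mod_cast hj
  have hpos : 0 < entropyFactor γ i j := by unfold entropyFactor; positivity
  rw [← Real.log_nonpos_iff hpos.le]
  unfold entropyFactor
  rw [Real.log_mul (by positivity) (by positivity), Real.log_pow, Real.log_pow]
  have ha := Real.log_le_sub_one_of_pos (x := (i + j : ℝ) * γ / i) (by positivity)
  have hb := Real.log_le_sub_one_of_pos (x := (i + j : ℝ) * (1 - γ) / j) (by positivity)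
  calc _ ≤ (i : ℝ) * ((i + j : ℝ) * γ / i - 1) + j * ((i + j : ℝ) * (1 - γ) / j - 1) := by gcongr
    _ = 0 := by field_simp; ring

theorem exp_neg_le_entropyFactor {γ : ℝ} (h0 : 0 < γ) (h1 : γ < 1) {i j : ℕ}
    (hi : 0 < i) (hj : 0 < j) (hclose : |(i : ℝ) - γ * (i + j)| ≤ 1) :
    Real.exp (-(1 / (γ * (1 - γ)))) ≤ entropyFactor γ i j := by
  have hδ : 0 < 1 - γ := by linarith
  have hi' : (1 : ℝ) ≤ i := by exact_mod_cast hi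
  have hj' : (1 : ℝ) ≤ j := by exact_mod_cast hj
  have hpos : 0 < entropyFactor γ i j := by unfold entropyFactor; positivity
  rw [← Real.le_log_iff_exp_le hpos]
  unfold entropyFactor
  rw [Real.log_mul (by positivity) (by positivity), Real.log_pow, Real.log_pow]
  have ha := Real.one_sub_inv_le_log_of_pos (x := (i + j : ℝ) * γ / i) (by positivity)
  have hb := Real.one_sub_inv_le_log_of_pos (x := (i + j : ℝ) * (1 - γ) / j) (by positivity)
  calc -(1 / (γ * (1 - γ)))
      ≤ -(((i : ℝ) - γ * (i + j)) ^ 2 / ((i + j) * (γ * (1 - γ)))) := by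
        rw [neg_le_neg_iff]
        apply div_le_div₀ (by norm_num) _ (by positivity)
        · nlinarith [mul_pos h0 hδ]
        · rw [← sq_abs]; nlinarith [abs_nonneg ((i : ℝ) - γ * (i + j))]
    _ = (i : ℝ) * (1 - ((i + j : ℝ) * γ / i)⁻¹) +
          j * (1 - ((i + j : ℝ) * (1 - γ) / j)⁻¹) := by field_simp; ring
    _ ≤ _ := by gcongr

theorem sq_sub_mul_binomialWeight_le {γ : ℝ} (h0 : 0 < γ) (h1 : γ < 1) (i j : ℕ) :
    ((i + j : ℝ) * γ - i) ^ 2 * binomialWeight γ i j ≤ (i + j : ℝ) := by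
  have hδ : 0 < 1 - γ := by linarith
  have h := congrArg (Polynomial.eval γ) (bernsteinPolynomial.variance ℝ (i + j))
  simp only [bernsteinPolynomial, Polynomial.eval_finsetSum, Polynomial.eval_mul,
    Polynomial.eval_pow, Polynomial.eval_sub, Polynomial.eval_one, Polynomial.eval_X,
    Polynomial.eval_natCast, nsmul_eq_mul] at h
  have hs := Finset.single_le_sum (s := Finset.range (i + j + 1))
    (f := fun ν => (((i + j : ℕ) : ℝ) * γ - ν) ^ 2 *
      (((i + j).choose ν : ℝ) * γ ^ ν * (1 - γ) ^ (i + j - ν)))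
    (fun ν _ => by positivity) (Finset.mem_range.2 (by omega : i < i + j + 1))
  rw [h] at hs
  simp only [Nat.add_sub_cancel_left] at hs
  push_cast at hs
  unfold binomialWeight
  refine hs.trans ?_
  rw [mul_assoc]
  exact mul_le_of_le_one_right (by positivity) (by nlinarith)

theorem exists_binomialWeight_le {γ : ℝ} (h0 : 0 < γ) (h1 : γ < 1) :
    ∃ A > 0, ∀ i j : ℕ, 0 < i + j → binomialWeight γ i j ≤ A / √(i + j : ℝ) := by
  have hδ : 0 < 1 - γ := by linarith
  have hγδ : 0 < γ * (1 - γ) := mul_pos h0 hδ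
  set d := γ * (1 - γ) / 2 with hd
  have hdpos : 0 < d := by positivity
  refine ⟨1 / d ^ 2, by positivity, fun i j hij => ?_⟩
  have hn : (1 : ℝ) ≤ (i + j : ℝ) := by exact_mod_cast hij
  set n : ℝ := (i + j : ℝ) with hndef
  have hs1 : 1 ≤ √n := Real.one_le_sqrt.2 hn
  have hsq : √n * √n = n := Real.mul_self_sqrt (by linarith)
  have hd1 : d ≤ 1 := by nlinarith
  by_cases hfar : d * n ≤ |n * γ - i|
  · have h := sq_sub_mul_binomialWeight_le h0 h1 i j
    rw [← hndef] at h
    have hb : 0 ≤ binomialWeight γ i j := by unfold binomialWeight; positivity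
    have hsq2 : (d * n) ^ 2 ≤ (n * γ - i) ^ 2 := by
      rw [← sq_abs (n * γ - i)]; gcongr
    have h2 : (d * n) ^ 2 * binomialWeight γ i j ≤ n :=
      (mul_le_mul_of_nonneg_right hsq2 hb).trans h
    have h3 : d ^ 2 * n * binomialWeight γ i j ≤ 1 := by
      refine le_of_mul_le_mul_right (a := n) ?_ (by linarith)
      linarith
    rw [div_div, le_div_iff₀ (by positivity)]
    calc _ = d ^ 2 * √n * binomialWeight γ i j := by ring
      _ ≤ d ^ 2 * n * binomialWeight γ i j := by
        gcongr
        nlinarith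
      _ ≤ 1 := h3
  · push Not at hfar
    rw [abs_lt] at hfar
    have hia : d * n ≤ i := by nlinarith
    have hja : d * n ≤ j := by nlinarith
    have hi : 0 < i := by
      have : (0 : ℝ) < i := lt_of_lt_of_le (by positivity) hia
      exact_mod_cast this
    have hj : 0 < j := by
      have : (0 : ℝ) < j := lt_of_lt_of_le (by positivity) hja
      exact_mod_cast this
    calc binomialWeight γ i j ≤ √n / (√i * √j) * entropyFactor γ i j :=
          binomialWeight_le_sqrt_mul_entropyFactor h0 h1 hi hj
      _ ≤ √n / (√i * √j) * 1 := by
          gcongr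
          exact entropyFactor_le_one h0 h1 hi hj
      _ ≤ √n / (√(d * n) * √(d * n)) := by
          rw [mul_one]
          gcongr
      _ = 1 / d / √n := by
          rw [Real.mul_self_sqrt (by positivity)]
          field_simp
          linarith
      _ ≤ 1 / d ^ 2 / √n := by
          gcongr
          nlinarith

theorem exists_le_binomialWeight {γ : ℝ} (h0 : 0 < γ) (h1 : γ < 1) :
    ∃ c > 0, ∀ i j : ℕ, 0 < i → 0 < j → |(i : ℝ) - γ * (i + j)| ≤ 1 →
      c / √(i + j : ℝ) ≤ binomialWeight γ i j := by
  refine ⟨2 / 9 * Real.exp (-(1 / (γ * (1 - γ)))), by positivity, fun i j hi hj hclose => ?_⟩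
  have hi' : (0 : ℝ) < i := by exact_mod_cast hi
  have hj' : (0 : ℝ) < j := by exact_mod_cast hj
  have hE := exp_neg_le_entropyFactor h0 h1 hi hj hclose
  have hb := sqrt_mul_entropyFactor_le_binomialWeight h0 h1 hi hj
  have hr : 1 / √(i + j : ℝ) ≤ √(i + j : ℝ) / (√i * √j) := by
    rw [div_le_div_iff₀ (by positivity) (by positivity), one_mul]
    gcongr <;> linarith
  calc _ = 2 / 9 * (1 / √(i + j : ℝ) * Real.exp (-(1 / (γ * (1 - γ))))) := by ring
    _ ≤ 2 / 9 * (√(i + j : ℝ) / (√i * √j) * entropyFactor γ i j) := by gcongr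
    _ ≤ _ := by linarith

theorem choose_eq_binomialWeight_div {γ : ℝ} (h0 : 0 < γ) (h1 : γ < 1) (i j : ℕ) :
    ((i + j).choose i : ℝ) = binomialWeight γ i j / (γ ^ i * (1 - γ) ^ j) := by
  have hδ : 0 < 1 - γ := by linarith
  unfold binomialWeight
  field_simp

theorem add_le_three_mul_sqrt {k T R : ℕ} (hk : 2 ≤ k) (hT : 1 ≤ T) (hR : k - 1 ≤ R)
    (hTR : T + R = k.choose 2) : ((T + R : ℕ) : ℝ) ≤ 3 * (R * √T) := by
  have hs1 : 1 ≤ √(T : ℝ) := Real.one_le_sqrt.2 (by exact_mod_cast hT)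
  have hsq : √(T : ℝ) * √T = T := Real.mul_self_sqrt (by positivity)
  have hkR : (k : ℝ) ≤ 2 * R := by
    have : k ≤ 2 * R := by omega
    exact_mod_cast this
  have hTk : (T : ℝ) ≤ (k : ℝ) ^ 2 := by
    have : T ≤ k ^ 2 := (by omega : T ≤ k.choose 2).trans (Nat.choose_le_pow k 2)
    exact_mod_cast this
  have hTk' : √(T : ℝ) ≤ k := by
    rw [Real.sqrt_le_left (by positivity)]
    exact hTk
  push_cast
  nlinarith

theorem pow_mul_pow_le_exp {γ p : ℝ} (hp : 0 < p) (hpγ : p < γ) (hγ : γ < 1) {T f r : ℕ}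
    (hf : (f : ℝ) ≤ γ * T) (hT : f + r ≤ T) :
    (γ / p) ^ (f + r) * ((1 - γ) / (1 - p)) ^ (T - (f + r)) ≤
      (2 * (γ / (1 - γ)) * ((1 - p) / p)) ^ r * Real.exp (T * alphaQC γ p) := by
  have h0 : 0 < γ := hp.trans hpγ
  have hδ : 0 < 1 - γ := by linarith
  have hq : 0 < 1 - p := by linarith
  have hu : 0 ≤ Real.log (γ / p) := Real.log_nonneg ((one_le_div hp).2 hpγ.le)
  have hv : Real.log ((1 - γ) / (1 - p)) ≤ 0 :=
    Real.log_nonpos (by positivity) ((div_le_one hq).2 (by linarith))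
  set x := γ / p with hx
  set y := (1 - γ) / (1 - p) with hy
  have hxpos : 0 < x := by positivity
  have hypos : 0 < y := by positivity
  have hlam : 2 * (γ / (1 - γ)) * ((1 - p) / p) = 2 * (x / y) := by
    rw [hx, hy]; field_simp
  clear_value x y
  obtain ⟨m, rfl⟩ : ∃ m, T = f + r + m := ⟨T - (f + r), by omega⟩
  have hexp : x ^ f * y ^ (r + m) ≤ Real.exp (((f + r + m : ℕ) : ℝ) * alphaQC γ p) := by
    rw [← Real.log_le_iff_le_exp (by positivity), Real.log_mul (by positivity) (by positivity),
      Real.log_pow, Real.log_pow, alphaQC, ← hx, ← hy]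
    push_cast at hf ⊢
    nlinarith
  calc x ^ (f + r) * y ^ (f + r + m - (f + r))
      = (x / y) ^ r * (x ^ f * y ^ (r + m)) := by
        rw [Nat.add_sub_cancel_left, div_pow, pow_add, pow_add]; field_simp
    _ ≤ (2 * (x / y)) ^ r * Real.exp (((f + r + m : ℕ) : ℝ) * alphaQC γ p) := by
        gcongr
        have : 0 < x / y := by positivity
        linarith
    _ = _ := by rw [hlam]

theorem choose_mul_sq_choose_eq {γ p : ℝ} (h0 : 0 < γ) (h1 : γ < 1) (hp : 0 < p) (hp1 : p < 1)
    (a b c d : ℕ) :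
    ((a + b).choose a : ℝ) * ((c + d).choose c : ℝ) ^ 2 *
        ((a + c + (b + d)).choose (a + c) : ℝ)⁻¹ ^ 2 * p ^ (-(a : ℤ)) * (1 - p) ^ (-(b : ℤ)) =
      binomialWeight γ a b * binomialWeight γ c d ^ 2 / binomialWeight γ (a + c) (b + d) ^ 2 *
        ((γ / p) ^ a * ((1 - γ) / (1 - p)) ^ b) := by
  have hδ : 0 < 1 - γ := by linarith
  have hq : 0 < 1 - p := by linarith
  have hpos : 0 < binomialWeight γ (a + c) (b + d) := by
    have : 0 < (a + c + (b + d)).choose (a + c) := Nat.choose_pos (by omega)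
    unfold binomialWeight
    positivity
  rw [choose_eq_binomialWeight_div h0 h1 a b, choose_eq_binomialWeight_div h0 h1 c d,
    choose_eq_binomialWeight_div h0 h1 (a + c) (b + d), zpow_neg, zpow_neg, zpow_natCast,
    zpow_natCast, div_pow γ, div_pow (1 - γ), pow_add γ, pow_add (1 - γ)]
  field_simp

theorem binomialWeight_mul_sq_div_le {A c' : ℝ} {γ : ℝ} (h0 : 0 < γ) (h1 : γ < 1)
    (hA : 0 < A) (hc' : 0 < c')
    (hup : ∀ i j : ℕ, 0 < i + j → binomialWeight γ i j ≤ A / √(i + j : ℝ))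
    {a b c d : ℕ} (hT : 0 < a + b) (hR : 0 < c + d)
    (hlow : c' / √((a + c : ℕ) + (b + d : ℕ) : ℝ) ≤ binomialWeight γ (a + c) (b + d))
    (hsize : ((a + b + (c + d) : ℕ) : ℝ) ≤ 3 * ((c + d : ℕ) * √(a + b : ℕ))) :
    binomialWeight γ a b * binomialWeight γ c d ^ 2 / binomialWeight γ (a + c) (b + d) ^ 2 ≤
      3 * A ^ 3 / c' ^ 2 := by
  have hδ : 0 < 1 - γ := by linarith
  have hab := hup a b hT
  have hcd := hup c d hR
  have hcd0 : 0 ≤ binomialWeight γ c d := by unfold binomialWeight; positivity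
  have hT' : (0 : ℝ) < (a + b : ℝ) := by exact_mod_cast hT
  have hR' : (0 : ℝ) < (c + d : ℝ) := by exact_mod_cast hR
  have hS : ((a + c : ℕ) + (b + d : ℕ) : ℝ) = (a + b) + (c + d) := by push_cast; ring
  rw [hS] at hlow
  push_cast at hsize
  calc _ ≤ A / √(a + b : ℝ) * (A / √(c + d : ℝ)) ^ 2 / (c' / √((a + b) + (c + d) : ℝ)) ^ 2 := by
        gcongr
    _ = A ^ 3 / c' ^ 2 * (((a + b) + (c + d)) / ((c + d) * √(a + b : ℝ))) := by
        rw [div_pow, div_pow, Real.sq_sqrt hR'.le, Real.sq_sqrt (by positivity)]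
        field_simp
    _ ≤ A ^ 3 / c' ^ 2 * 3 := by
        gcongr
        rw [div_le_iff₀ (by positivity)]
        exact hsize
    _ = _ := by ring

theorem sub_one_add_choose_two_le {k ℓ : ℕ} (h : ℓ + 1 ≤ k) :
    k - 1 + ℓ.choose 2 ≤ k.choose 2 := by
  obtain ⟨m, rfl⟩ : ∃ m, k = m + 1 := ⟨k - 1, by omega⟩
  have h1 : (m + 1).choose 2 = m + m.choose 2 := by
    rw [Nat.choose_succ_succ' m 1, Nat.choose_one_right]
  have h2 : ℓ.choose 2 ≤ m.choose 2 := Nat.choose_le_choose 2 (by omega)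
  omega

/-- Lemma 5, inequality (7) of the paper: with `λ = 2·(γ/(1−γ))·((1−p)/p)` and `T = C(ℓ,2)`,
for all large `k`, all `ℓ ∈ {2,…,k−1}` and all integers `r ≥ 0` with `⌊γT⌋ + r ≤ T`,
`R_ℓ(⌊γT⌋ + r) ≤ λ^r · e^{T·α(γ,p) + O(1)}`. -/
theorem Rquot_upper_bound
    (p γ : ℝ) (hp : 0 < p) (hpγ : p < γ) (hγ : γ < 1) :
    ∃ C > 0, ∃ k₀ : ℕ, ∀ k ≥ k₀, ∀ ℓ : ℕ, 2 ≤ ℓ → ℓ + 1 ≤ k →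
      ∀ r : ℕ, ⌊γ * (ℓ.choose 2 : ℝ)⌋₊ + r ≤ ℓ.choose 2 →
        Rquot γ p k ℓ (⌊γ * (ℓ.choose 2 : ℝ)⌋₊ + r)
          ≤ (2 * (γ / (1 - γ)) * ((1 - p) / p)) ^ r *
              Real.exp ((ℓ.choose 2 : ℝ) * alphaQC γ p + C) := by
  have h0 : 0 < γ := hp.trans hpγ
  have hp1 : p < 1 := hpγ.trans hγ
  have hδ : 0 < 1 - γ := by linarith
  have hq : 0 < 1 - p := by linarith
  obtain ⟨A, hA, hup⟩ := exists_binomialWeight_le h0 hγ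
  obtain ⟨c', hc', hlow⟩ := exists_le_binomialWeight h0 hγ
  set K := 3 * A ^ 3 / c' ^ 2 with hK
  have hKpos : 0 < K := by positivity
  refine ⟨|Real.log K| + 1, by positivity, ⌈1 / (1 - γ)⌉₊ + 3, fun k hk ℓ hℓ hℓk r hr => ?_⟩
  have hRk := sub_one_add_choose_two_le hℓk
  have hTpos : 0 < ℓ.choose 2 := Nat.choose_pos hℓ
  have hrhs : 0 < 2 * (γ / (1 - γ)) * ((1 - p) / p) := by positivity
  unfold Rquot
  have hfT : (⌊γ * (ℓ.choose 2 : ℝ)⌋₊ : ℝ) ≤ γ * (ℓ.choose 2 : ℝ) := Nat.floor_le (by positivity)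
  have hexp := pow_mul_pow_le_exp hp hpγ hγ hfT hr
  set L := ⌊γ * (ℓ.choose 2 : ℝ)⌋₊ + r with hL
  have hSk : k - 1 ≤ k.choose 2 := by omega
  have hSlarge : 1 / (1 - γ) < (k.choose 2 : ℝ) := by
    refine (Nat.le_ceil _).trans_lt ?_
    exact_mod_cast (by omega : ⌈1 / (1 - γ)⌉₊ < k.choose 2)
  have hSpos : (0 : ℝ) < k.choose 2 := lt_trans (by positivity) hSlarge
  have hM1 := Nat.le_ceil (γ * (k.choose 2 : ℝ))
  have hM2 := Nat.ceil_lt_add_one (a := γ * (k.choose 2 : ℝ)) (by positivity)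
  have hMpos : 0 < ⌈γ * (k.choose 2 : ℝ)⌉₊ := Nat.ceil_pos.2 (by positivity)
  rw [div_lt_iff₀ hδ] at hSlarge
  set M := ⌈γ * (k.choose 2 : ℝ)⌉₊ with hM
  have hMS : M < k.choose 2 := by
    have : (M : ℝ) < k.choose 2 := by linarith
    exact_mod_cast this
  by_cases hz : L ≤ M ∧ M - L ≤ k.choose 2 - ℓ.choose 2
  · obtain ⟨hLM, hMR⟩ := hz
    have hch : chooseZ (k.choose 2 - ℓ.choose 2) ((M : ℤ) - (L : ℤ)) =
        (k.choose 2 - ℓ.choose 2).choose (M - L) := by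
      rw [chooseZ, if_pos (by omega)]
      congr 1
      omega
    rw [hch]
    have hsize := add_le_three_mul_sqrt (k := k) (T := ℓ.choose 2)
      (R := k.choose 2 - ℓ.choose 2) (by omega) hTpos (by omega) (by omega)
    have hRpos : 0 < k.choose 2 - ℓ.choose 2 := by omega
    generalize hTe : ℓ.choose 2 = T at *
    generalize hSe : k.choose 2 = S at *
    generalize hRe : S - T = R at *
    obtain ⟨b, rfl⟩ : ∃ b, T = L + b := ⟨T - L, by omega⟩
    obtain ⟨c, hc⟩ : ∃ c, M = L + c := ⟨M - L, by omega⟩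
    rw [hc, Nat.add_sub_cancel_left] at hMR
    obtain ⟨d, rfl⟩ : ∃ d, R = c + d := ⟨R - c, by omega⟩
    obtain rfl : S = L + c + (b + d) := by omega
    have hMl : M - L = c := by omega
    have hz2 : (L : ℤ) - ((L + b : ℕ) : ℤ) = -(b : ℤ) := by push_cast; ring
    rw [hMl, hz2]
    rw [hc] at hM1 hM2 hMS ⊢
    rw [choose_mul_sq_choose_eq h0 hγ hp hp1]
    rw [Nat.add_sub_cancel_left] at hexp
    have hlow' := hlow (L + c) (b + d) (by omega) (by omega) (by
      rw [← Nat.cast_add, abs_le]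
      constructor <;> linarith)
    have hmain := binomialWeight_mul_sq_div_le h0 hγ hA hc' hup hTpos hRpos hlow' hsize
    have hKexp : K ≤ Real.exp (|Real.log K| + 1) := by
      rw [← Real.log_le_iff_le_exp hKpos]
      linarith [le_abs_self (Real.log K)]
    rw [Real.exp_add]
    calc _ ≤ K * ((γ / p) ^ L * ((1 - γ) / (1 - p)) ^ b) := by gcongr
      _ ≤ Real.exp (|Real.log K| + 1) * ((2 * (γ / (1 - γ)) * ((1 - p) / p)) ^ r *
            Real.exp (((L + b : ℕ) : ℝ) * alphaQC γ p)) := by gcongr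
      _ = _ := by ring
  · have hch : chooseZ (k.choose 2 - ℓ.choose 2) ((M : ℤ) - (L : ℤ)) = 0 := by
      rw [chooseZ]
      split_ifs with hnn
      · exact Nat.choose_eq_zero_of_lt (by omega)
      · rfl
    rw [hch]
    simp only [Nat.cast_zero, ne_eq, OfNat.ofNat_ne_zero, not_false_eq_true, zero_pow, mul_zero,
      zero_mul]
    positivity
end
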